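/- Adding 8 ballots of the form C₃≻C₂≻C₁≻C₄≻C₅ to the 4000-voter profile of the previous election (1003:C₁≻C₂≻…, 373:C₂≻C₄, 374:C₂≻C₅, 375:C₃≻C₄, 376:C₃≻C₅, 374:C₄≻C₂, 374:C₄≻C₃, 375:C₅≻C₂, 376:C₅≻C₃) raises the quota to 1003, so C₁ is elected with zero surplus; then C₂ (747 votes, fewest) is eliminated; the 373 transferable C₂-ballots go to C₄ and 374 go to C₅, giving C₄ 1121 and C₅ 1125, both elected. The winner set changes from {C₁,C₂,C₃} to {C₁,C₄,C₅}: the added ballots rank C₃ first yet C₃ loses, and rank C₅ last yet C₅ wins, exhibiting simultaneous paradoxes of positive and negative involvement. -/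

import Mathlib

section STV

variable {C : Type*} [DecidableEq C] [LinearOrder C]

/-- A weighted ballot: a ranking of candidates together with its current
(rational) weight. -/
abbrev WBallot (C : Type*) := List C × ℚ

/-- The highest-ranked candidate on a ballot who is still remaining (neither
elected nor eliminated). -/
def wtop (rem : Finset C) (b : WBallot C) : Option C := b.1.find? (· ∈ rem)

/-- The current vote total of candidate `c`: the total weight of the ballots
whose highest-ranked remaining candidate is `c`. -/
def wscore (ballots : List (WBallot C)) (rem : Finset C) (c : C) : ℚ :=
  ((ballots.filter (fun b => wtop rem b = some c)).map Prod.snd).sum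

/-- A remaining candidate with the largest current vote total (ties broken
deterministically by the linear order on `C`). -/
def argmaxScore (ballots : List (WBallot C)) (rem : Finset C) (h : rem.Nonempty) : C :=
  (rem.filter (fun c => ∀ d ∈ rem, wscore ballots rem d ≤ wscore ballots rem c)).min'
    (by
      obtain ⟨c, hc, hmax⟩ := rem.exists_max_image (wscore ballots rem) h
      exact ⟨c, Finset.mem_filter.mpr ⟨hc, hmax⟩⟩)

/-- A remaining candidate with the smallest current vote total (ties broken
deterministically by the linear order on `C`). -/
def argminScore (ballots : List (WBallot C)) (rem : Finset C) (h : rem.Nonempty) : C :=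
  (rem.filter (fun c => ∀ d ∈ rem, wscore ballots rem c ≤ wscore ballots rem d)).min'
    (by
      obtain ⟨c, hc, hmin⟩ := rem.exists_min_image (wscore ballots rem) h
      exact ⟨c, Finset.mem_filter.mpr ⟨hc, hmin⟩⟩)

theorem argmaxScore_mem (ballots : List (WBallot C)) (rem : Finset C) (h : rem.Nonempty) :
    argmaxScore ballots rem h ∈ rem :=
  Finset.filter_subset _ _ (Finset.min'_mem _ _)

theorem argminScore_mem (ballots : List (WBallot C)) (rem : Finset C) (h : rem.Nonempty) :
    argminScore ballots rem h ∈ rem :=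
  Finset.filter_subset _ _ (Finset.min'_mem _ _)

/-- Proportional surplus transfer: when candidate `c` is elected with vote total
`s ≥ q`, every ballot currently counting for `c` is rescaled by `(s - q)/s`, so
that exactly the surplus `s - q` is passed on to the next remaining candidates
on those ballots. -/
def transferSurplus (ballots : List (WBallot C)) (rem : Finset C) (c : C) (q : ℚ) :
    List (WBallot C) :=
  let s := wscore ballots rem c
  ballots.map (fun b => if wtop rem b = some c then (b.1, b.2 * ((s - q) / s)) else b)

/-- One run of STV with quota `q` and `S` seats: in each round, if some remaining
candidate reaches quota, the one with the largest vote total is elected and their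
surplus is transferred proportionally; otherwise the candidate with the fewest
votes is eliminated and their ballots transfer at full value.  The process stops
when `S` candidates are elected, or when the remaining candidates suffice only to
fill the open seats (in which case they are all seated). -/
def stvAux (S : ℕ) (q : ℚ) (ballots : List (WBallot C)) (rem elected : Finset C) :
    Finset C :=
  if h1 : S ≤ elected.card then elected
  else if h2 : rem.card + elected.card ≤ S then elected ∪ rem
  else
    have h : rem.Nonempty := Finset.card_pos.mp (by omega)
    if (rem.filter (fun c => q ≤ wscore ballots rem c)).Nonempty then
      let c := argmaxScore ballots rem h
      stvAux S q (transferSurplus ballots rem c q) (rem.erase c) (insert c elected)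
    else
      stvAux S q ballots (rem.erase (argminScore ballots rem h)) elected
termination_by rem.card
decreasing_by
  · exact Finset.card_erase_lt_of_mem (argmaxScore_mem _ _ _)
  · exact Finset.card_erase_lt_of_mem (argminScore_mem _ _ _)

/-- The STV winner set for a profile of ballots (each with weight 1) with `S`
seats and Droop quota `⌊V/(S+1)⌋ + 1`. -/
def stvWinners [Fintype C] (S : ℕ) (P : List (List C)) : Finset C :=
  stvAux S ((P.length / (S + 1) + 1 : ℕ) : ℚ) (P.map (fun r => (r, (1 : ℚ))))
    Finset.univ ∅

end STV

/-- Candidates `C₁,…,C₅` are `0,…,4 : Fin 5`.  The 4000-voter profile of the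
previous election. -/
def P10 : List (List (Fin 5)) :=
  List.replicate 1003 [0, 1] ++ List.replicate 373 [1, 3] ++
  List.replicate 374 [1, 4] ++ List.replicate 375 [2, 3] ++
  List.replicate 376 [2, 4] ++ List.replicate 374 [3, 1] ++
  List.replicate 374 [3, 2] ++ List.replicate 375 [4, 1] ++
  List.replicate 376 [4, 2]

/-- The profile after adding 8 ballots of the form `C₃≻C₂≻C₁≻C₄≻C₅`. -/
def P10' : List (List (Fin 5)) := P10 ++ List.replicate 8 [2, 1, 0, 3, 4]

section STV

variable {C : Type*} [DecidableEq C]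

/-- The ballots of a profile given as groups of identical ballots with multiplicities. -/
def expandGroups (G : List (ℕ × WBallot C)) : List (WBallot C) :=
  G.flatMap fun g => List.replicate g.1 g.2

/-- The vote total of `c`, computed group by group. -/
def groupScore (G : List (ℕ × WBallot C)) (rem : Finset C) (c : C) : ℚ :=
  (G.map fun g => if wtop rem g.2 = some c then (g.1 : ℚ) * g.2.2 else 0).sum

/-- Proportional surplus transfer, performed group by group. -/
def groupTransfer (G : List (ℕ × WBallot C)) (rem : Finset C) (c : C) (q : ℚ) :
    List (ℕ × WBallot C) :=
  let s := groupScore G rem c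
  G.map fun g => (g.1, if wtop rem g.2 = some c then (g.2.1, g.2.2 * ((s - q) / s)) else g.2)

theorem wscore_expandGroups (G : List (ℕ × WBallot C)) (rem : Finset C) (c : C) :
    wscore (expandGroups G) rem c = groupScore G rem c := by
  induction G with
  | nil => rfl
  | cons g G ih =>
    simp only [wscore, groupScore, expandGroups, List.flatMap_cons, List.filter_append,
      List.map_append, List.sum_append, List.map_cons, List.sum_cons] at ih ⊢
    rw [ih, List.filter_replicate]
    congr 1
    split_ifs <;> simp_all

theorem transferSurplus_expandGroups (G : List (ℕ × WBallot C)) (rem : Finset C) (c : C) (q : ℚ) :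
    transferSurplus (expandGroups G) rem c q = expandGroups (groupTransfer G rem c q) := by
  simp only [transferSurplus, groupTransfer, wscore_expandGroups]
  simp [expandGroups, List.map_flatMap, List.flatMap_map]

variable [LinearOrder C]

theorem argmaxScore_eq {ballots : List (WBallot C)} {rem : Finset C} (h : rem.Nonempty) {c : C}
    (hc : c ∈ rem) (hmax : ∀ d ∈ rem, d ≠ c → wscore ballots rem d < wscore ballots rem c) :
    argmaxScore ballots rem h = c := by
  by_contra hne
  have hmem : argmaxScore ballots rem h ∈
      rem.filter fun c => ∀ d ∈ rem, wscore ballots rem d ≤ wscore ballots rem c := Finset.min'_mem _ _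
  have hle := (Finset.mem_filter.mp hmem).2 c hc
  exact (hmax _ (argmaxScore_mem ballots rem h) hne).not_ge hle

theorem argminScore_eq {ballots : List (WBallot C)} {rem : Finset C} (h : rem.Nonempty) {c : C}
    (hc : c ∈ rem) (hmin : ∀ d ∈ rem, d ≠ c → wscore ballots rem c < wscore ballots rem d) :
    argminScore ballots rem h = c := by
  by_contra hne
  have hmem : argminScore ballots rem h ∈
      rem.filter fun c => ∀ d ∈ rem, wscore ballots rem c ≤ wscore ballots rem d := Finset.min'_mem _ _
  have hle := (Finset.mem_filter.mp hmem).2 c hc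
  exact (hmin _ (argminScore_mem ballots rem h) hne).not_ge hle

theorem stvAux_of_le_card {S : ℕ} {q : ℚ} {ballots : List (WBallot C)} {rem elected : Finset C}
    (h : S ≤ elected.card) : stvAux S q ballots rem elected = elected := by
  rw [stvAux, dif_pos h]

theorem stvAux_elect {S : ℕ} {q : ℚ} {G : List (ℕ × WBallot C)} {rem elected : Finset C} (c : C)
    (hS : elected.card < S) (hrem : S < rem.card + elected.card) (hc : c ∈ rem)
    (hq : q ≤ groupScore G rem c)
    (hmax : ∀ d ∈ rem, d ≠ c → groupScore G rem d < groupScore G rem c) :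
    stvAux S q (expandGroups G) rem elected =
      stvAux S q (expandGroups (groupTransfer G rem c q)) (rem.erase c) (insert c elected) := by
  simp only [← wscore_expandGroups] at hq hmax
  rw [stvAux, dif_neg hS.not_ge, dif_neg hrem.not_ge,
    if_pos ⟨c, Finset.mem_filter.mpr ⟨hc, hq⟩⟩]
  simp only [argmaxScore_eq _ hc hmax, transferSurplus_expandGroups]

theorem stvAux_eliminate {S : ℕ} {q : ℚ} {G : List (ℕ × WBallot C)} {rem elected : Finset C}
    (c : C) (hS : elected.card < S) (hrem : S < rem.card + elected.card) (hc : c ∈ rem)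
    (hq : ∀ d ∈ rem, groupScore G rem d < q)
    (hmin : ∀ d ∈ rem, d ≠ c → groupScore G rem c < groupScore G rem d) :
    stvAux S q (expandGroups G) rem elected =
      stvAux S q (expandGroups G) (rem.erase c) elected := by
  simp only [← wscore_expandGroups] at hq hmin
  rw [stvAux, dif_neg hS.not_ge, dif_neg hrem.not_ge, if_neg]
  · rw [argminScore_eq _ hc hmin]
  · rintro ⟨d, hd⟩
    rw [Finset.mem_filter] at hd
    exact (hq d hd.1).not_ge hd.2

end STV

/-- The ballots of `P10`, grouped. -/
def groupsP10 : List (ℕ × WBallot (Fin 5)) :=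
  [(1003, [0, 1], 1), (373, [1, 3], 1), (374, [1, 4], 1), (375, [2, 3], 1), (376, [2, 4], 1),
    (374, [3, 1], 1), (374, [3, 2], 1), (375, [4, 1], 1), (376, [4, 2], 1)]

/-- The ballots of `P10'`, grouped. -/
def groupsP10' : List (ℕ × WBallot (Fin 5)) := groupsP10 ++ [(8, [2, 1, 0, 3, 4], 1)]

theorem P10_ballots : P10.map (fun r => (r, (1 : ℚ))) = expandGroups groupsP10 := by
  simp only [P10, groupsP10, expandGroups, List.map_append, List.map_replicate,
    List.flatMap_cons, List.flatMap_nil, List.append_nil, List.append_assoc]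

theorem P10'_ballots : P10'.map (fun r => (r, (1 : ℚ))) = expandGroups groupsP10' := by
  rw [P10', List.map_append, P10_ballots, List.map_replicate]
  simp only [groupsP10', expandGroups, List.flatMap_append, List.flatMap_cons, List.flatMap_nil,
    List.append_nil]

theorem P10_length : P10.length = 4000 := by
  simp only [P10, List.length_append, List.length_replicate]

theorem P10'_length : P10'.length = 4008 := by
  simp [P10', P10_length]

theorem stvWinners_P10 : stvWinners 3 P10 = {0, 1, 2} := by
  rw [stvWinners, P10_length, P10_ballots,
    stvAux_elect 0 (by decide) (by decide) (by decide) (by decide +kernel) (by decide +kernel),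
    stvAux_eliminate 3 (by decide) (by decide) (by decide) (by decide +kernel) (by decide +kernel),
    stvAux_elect 2 (by decide) (by decide) (by decide) (by decide +kernel) (by decide +kernel),
    stvAux_elect 1 (by decide) (by decide) (by decide) (by decide +kernel) (by decide +kernel),
    stvAux_of_le_card (by decide)]
  decide

theorem stvWinners_P10' : stvWinners 3 P10' = {0, 3, 4} := by
  rw [stvWinners, P10'_length, P10'_ballots,
    stvAux_elect 0 (by decide) (by decide) (by decide) (by decide +kernel) (by decide +kernel),
    stvAux_eliminate 1 (by decide) (by decide) (by decide) (by decide +kernel) (by decide +kernel),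
    stvAux_elect 4 (by decide) (by decide) (by decide) (by decide +kernel) (by decide +kernel),
    stvAux_elect 3 (by decide) (by decide) (by decide) (by decide +kernel) (by decide +kernel),
    stvAux_of_le_card (by decide)]
  decide

/-- Simultaneous paradoxes of positive and negative involvement in 3-seat STV:
adding 8 ballots `C₃≻C₂≻C₁≻C₄≻C₅` raises the quota to `⌊4008/4⌋ + 1 = 1003`, so
`C₁` is elected with zero surplus; then `C₂` (747 votes, the fewest) is
eliminated; its 373 transferable ballots go to `C₄` and 374 go to `C₅`, giving
`C₄` 1121 and `C₅` 1125 votes, both elected.  The winner set changes from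
`{C₁, C₂, C₃}` to `{C₁, C₄, C₅}`: the added ballots rank `C₃` first yet `C₃`
loses, and rank `C₅` last yet `C₅` wins. -/
theorem stv_double_involvement_P10 :
    stvWinners 3 P10 = {0, 1, 2} ∧
    P10'.length = 4008 ∧ (4008 / 4 + 1 : ℕ) = 1003 ∧
    wscore (P10'.map (fun r => (r, (1 : ℚ)))) Finset.univ 0 = 1003 ∧
    wscore (P10'.map (fun r => (r, (1 : ℚ)))) Finset.univ 1 = 747 ∧
    (748 + 373 : ℚ) = 1121 ∧ (1003 : ℚ) ≤ 1121 ∧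
    (751 + 374 : ℚ) = 1125 ∧ (1003 : ℚ) ≤ 1125 ∧
    stvWinners 3 P10' = {0, 3, 4} := by
  refine ⟨stvWinners_P10, P10'_length, by norm_num, ?_, ?_, by norm_num, by norm_num, by norm_num,
    by norm_num, stvWinners_P10'⟩ <;>
  · rw [P10'_ballots, wscore_expandGroups]
    decide +kernel
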